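/- Suppose H is a [3]-graph on n ≥ 69 vertices such that every pair of non-adjacent vertices u, v satisfies d_{∂H}(u) + d_{∂H}(v) ≥ n + 65, and H contains no Hamiltonian Berge cycle. Let C be a longest Berge cycle in H, with |V(C)| ∈ {n−1, n−2}, and let u ∈ V(H) − V(C). Then for every vertex v with (n+65)/2 − 3 > d_C(v), or with (n+65)/2 − 3 ≤ d_C(v) < 3n/4 + 13, the vertices u and v are adjacent. (That is, u is adjacent to every vertex of S(C) ∪ B_1(C), where S(C) = {v : d_C(v) < (n+65)/2 − 3} and B_1(C) = {v : (n+65)/2 − 3 ≤ d_C(v) < 3n/4 + 13}.) -/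

import Mathlib

/-- Two vertices are adjacent in the hypergraph with edge set `H`
if some edge contains both of them. -/
def HAdj {V : Type*} (H : Finset (Finset V)) (u v : V) : Prop :=
  u ≠ v ∧ ∃ e ∈ H, u ∈ e ∧ v ∈ e

/-- The degree of `u` in the 2-shadow `∂H`: the number of vertices adjacent to `u`. -/
noncomputable def shadowDeg {V : Type*} (H : Finset (Finset V)) (u : V) : ℕ :=
  {v | HAdj H u v}.ncard

/-- A `[3]`-graph: every edge has exactly 2 or 3 vertices. -/
def IsThreeGraph {V : Type*} (H : Finset (Finset V)) : Prop :=
  ∀ e ∈ H, e.card = 2 ∨ e.card = 3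

/-- A Berge cycle of length `t` in the hypergraph with edge set `H`:
`t` distinct vertices `vtx i` and `t` distinct edges `edge i` (indices mod `t`)
with `{vtx i, vtx (i+1)} ⊆ edge i` for every `i`. -/
structure BergeCycle {V : Type*} (H : Finset (Finset V)) (t : ℕ) where
  vtx : ZMod t → V
  edge : ZMod t → Finset V
  vtx_inj : Function.Injective vtx
  edge_inj : Function.Injective edge
  edge_mem : ∀ i, edge i ∈ H
  mem_fst : ∀ i, vtx i ∈ edge i
  mem_snd : ∀ i, vtx (i + 1) ∈ edge i

/-- `d_C(u)`: the number of vertices of the Berge cycle `C` adjacent to `u`. -/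
noncomputable def BergeCycle.dC {V : Type*} {H : Finset (Finset V)} {t : ℕ}
    (C : BergeCycle H t) (u : V) : ℕ :=
  {v | v ∈ Set.range C.vtx ∧ HAdj H u v}.ncard

/-- `H` contains a Hamiltonian Berge cycle, i.e. a Berge cycle whose
vertex set is all of `V`. -/
def HamiltonianBergeCycle {V : Type*} (H : Finset (Finset V)) : Prop :=
  ∃ (t : ℕ) (C : BergeCycle H t), Set.range C.vtx = Set.univ

/-- A set `U` of indices of vertices of the Berge cycle `C` is usable for `u`:
(1) for every `i ∈ U` there is an edge in `E(u, v_{i-1}) - {e_{i-2}}`;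
(2) any two distinct `i, j ∈ U` are non-consecutive on `C`;
(3) for every pair of distinct `i, j ∈ U` there are distinct edges
`e ∈ E(u, v_{i-1}) - {e_{i-2}}` and `e' ∈ E(u, v_{j-1}) - {e_{j-2}}`. -/
def Usable {V : Type*} {H : Finset (Finset V)} {t : ℕ} (C : BergeCycle H t) (u : V)
    (U : Set (ZMod t)) : Prop :=
  (∀ i ∈ U, ∃ e ∈ H, e ≠ C.edge (i - 2) ∧ u ∈ e ∧ C.vtx (i - 1) ∈ e) ∧
  (∀ i ∈ U, ∀ j ∈ U, i ≠ j → j ≠ i + 1 ∧ j ≠ i - 1) ∧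
  (∀ i ∈ U, ∀ j ∈ U, i ≠ j → ∃ e ∈ H, ∃ e' ∈ H, e ≠ e' ∧
    e ≠ C.edge (i - 2) ∧ u ∈ e ∧ C.vtx (i - 1) ∈ e ∧
    e' ≠ C.edge (j - 2) ∧ u ∈ e' ∧ C.vtx (j - 1) ∈ e')

/-- `CwBtw a b c` : on the cycle oriented clockwise, `b` lies strictly between
`a` and `c` on the clockwise arc from `a` to `c`. -/
def CwBtw {t : ℕ} (a b c : ZMod t) : Prop :=
  0 < (b - a).val ∧ (b - a).val < (c - a).val

/-- `e` is an `(i,j;k)`-bridge of the Berge cycle `C`. -/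
def IsBridge {V : Type*} [DecidableEq V] {H : Finset (Finset V)} {t : ℕ}
    (C : BergeCycle H t) (i j k : ZMod t) (e : Finset V) : Prop :=
  (CwBtw i k j ∧ ((e = C.edge (k + 1) ∧ e = {C.vtx i, C.vtx (k + 1), C.vtx (k + 2)}) ∨
                (e = C.edge (k - 1) ∧ e = {C.vtx j, C.vtx k, C.vtx (k - 1)}))) ∨
  (CwBtw j k i ∧ ((e = C.edge (k - 1) ∧ e = {C.vtx i, C.vtx k, C.vtx (k - 1)}) ∨
                (e = C.edge (k + 1) ∧ e = {C.vtx j, C.vtx (k + 1), C.vtx (k + 2)})))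

/-- `R(v_i, v_j)`: the set of bridges produced by the pair `{v_i, v_j}`,
i.e. all `(i,j;k)`-bridges over `k ∉ {i, j}`. -/
def RBridges {V : Type*} [DecidableEq V] {H : Finset (Finset V)} {t : ℕ}
    (C : BergeCycle H t) (i j : ZMod t) : Set (Finset V) :=
  {e | ∃ k : ZMod t, k ≠ i ∧ k ≠ j ∧ IsBridge C i j k e}


section Helpers

open Finset

/-- Build a Berge cycle from functions on naturals. -/
lemma mkCycle {V : Type*} {H : Finset (Finset V)} (N : ℕ) (hN : 2 ≤ N) (w : ℕ → V)
    (h : ℕ → Finset V)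
    (winj : ∀ a < N, ∀ b < N, w a = w b → a = b)
    (hinj : ∀ a < N, ∀ b < N, h a = h b → a = b)
    (hmem : ∀ a < N, h a ∈ H)
    (h1 : ∀ a < N, w a ∈ h a)
    (h2 : ∀ a, a + 1 < N → w (a + 1) ∈ h a)
    (h3 : w 0 ∈ h (N - 1)) : Nonempty (BergeCycle H N) := by
  have : NeZero N := ⟨by omega⟩
  have : Fact (1 < N) := ⟨by omega⟩
  refine ⟨⟨fun i => w i.val, fun i => h i.val, ?_, ?_, ?_, ?_, ?_⟩⟩
  · intro a b hab
    exact ZMod.val_injective N (winj _ (ZMod.val_lt a) _ (ZMod.val_lt b) hab)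
  · intro a b hab
    exact ZMod.val_injective N (hinj _ (ZMod.val_lt a) _ (ZMod.val_lt b) hab)
  · intro a
    exact hmem _ (ZMod.val_lt a)
  · intro a
    exact h1 _ (ZMod.val_lt a)
  · intro a
    have hlt := ZMod.val_lt a
    have e : (a + 1).val = (a.val + 1) % N := by
      rw [ZMod.val_add, ZMod.val_one]
    show w (a + 1).val ∈ h a.val
    rw [e]
    by_cases hc : a.val + 1 < N
    · rw [Nat.mod_eq_of_lt hc]
      exact h2 _ hc
    · have : a.val = N - 1 := by omega
      rw [this]
      have : N - 1 + 1 = N := by omega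
      rw [this, Nat.mod_self]
      exact h3

/-- A Berge path with vertices `w 0, …, w t` and edges `h 0, …, h (t-1)`. -/
structure BPath {V : Type*} (H : Finset (Finset V)) (t : ℕ) (w : ℕ → V)
    (h : ℕ → Finset V) : Prop where
  winj : ∀ a ≤ t, ∀ b ≤ t, w a = w b → a = b
  hinj : ∀ a < t, ∀ b < t, h a = h b → a = b
  hmem : ∀ a < t, h a ∈ H
  h1 : ∀ a < t, w a ∈ h a
  h2 : ∀ a < t, w (a + 1) ∈ h a

lemma BPath.close {V : Type*} {H : Finset (Finset V)} {t : ℕ} {w : ℕ → V}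
    {h : ℕ → Finset V} (P : BPath H t w h) (ht : 1 ≤ t)
    (hno : IsEmpty (BergeCycle H (t + 1)))
    (g : Finset V) (hg : g ∈ H) (hgp : ∀ a < t, h a ≠ g) (g0 : w 0 ∈ g) (g1 : w t ∈ g) :
    False := by
  obtain ⟨c⟩ := mkCycle (H := H) (t + 1) (by omega) w (fun r => if r < t then h r else g)
    (fun a ha b hb => P.winj a (by omega) b (by omega))
    (by
      intro a ha b hb hab
      have := P.hinj a
      have := hgp a
      have := hgp b
      grind)
    (by
      intro a ha
      have := P.hmem a
      grind)
    (by
      intro a ha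
      have := P.h1 a
      grind)
    (by
      intro a ha
      have := P.h2 a
      grind)
    (by simpa using g0)
  exact hno.false c

lemma BPath.cross {V : Type*} {H : Finset (Finset V)} {t : ℕ} {w : ℕ → V}
    {h : ℕ → Finset V} (P : BPath H t w h) (ht : 1 ≤ t)
    (hno : IsEmpty (BergeCycle H (t + 1))) (s : ℕ) (hs : s < t)
    (g g' : Finset V) (hgg : g ≠ g') (hg : g ∈ H) (hg' : g' ∈ H)
    (hgp : ∀ a < t, h a ≠ g) (hgp' : ∀ a < t, h a ≠ g')
    (g0 : w 0 ∈ g) (g1 : w (s + 1) ∈ g) (g0' : w s ∈ g') (g1' : w t ∈ g') :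
    False := by
  obtain ⟨c⟩ := mkCycle (H := H) (t + 1) (by omega)
    (fun r => if r ≤ s then w r else w (t + s + 1 - r))
    (fun r => if r < s then h r else if r = s then g' else if r = t then g
      else h (t + s - r))
    (by
      intro a ha b hb hab
      split_ifs at hab
      all_goals
        have := P.winj _ (by omega) _ (by omega) hab
        omega)
    (by
      intro a ha b hb hab
      split_ifs at hab
      all_goals first
        | omega
        | exact absurd hab hgg
        | exact absurd hab.symm hgg
        | exact absurd hab (hgp _ (by omega))
        | exact absurd hab.symm (hgp _ (by omega))
        | exact absurd hab (hgp' _ (by omega))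
        | exact absurd hab.symm (hgp' _ (by omega))
        | (have := P.hinj _ (by omega) _ (by omega) hab
           omega))
    (by
      intro a ha
      split_ifs
      all_goals first
        | assumption
        | exact P.hmem _ (by omega))
    (by
      intro a ha
      split_ifs with i1 i2 i3 i4 i5
      all_goals first
        | omega
        | exact P.h1 _ (by omega)
        | (have e : a = s := by omega
           rw [e]; exact g0')
        | (have e : t + s + 1 - a = s + 1 := by omega
           rw [e]; exact g1)
        | (convert P.h2 (t + s - a) (by omega) using 2; omega))
    (by
      intro a ha
      split_ifs with i1 i2 i3 i4 i5
      all_goals first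
        | omega
        | exact P.h2 _ (by omega)
        | (convert g1' using 2; omega)
        | (convert P.h1 (t + s - a) (by omega) using 2; omega))
    (by
      have a1 : ¬ (t < s) := by omega
      have a2 : ¬ (t = s) := by omega
      simpa [a1, a2] using g0)
  exact hno.false c

lemma BPath.ore {V : Type*} [Fintype V] {H : Finset (Finset V)} (h3 : IsThreeGraph H)
    {t : ℕ} {w : ℕ → V}
    {h : ℕ → Finset V} (P : BPath H t w h) (ht : 1 ≤ t)
    (hno : IsEmpty (BergeCycle H (t + 1))) (hna : ¬ HAdj H (w 0) (w t))
    (D0 D1 : Finset (Finset V))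
    (hD0 : ∀ a < t, w 0 ∈ h a → h a ∈ D0) (hD1 : ∀ a < t, w t ∈ h a → h a ∈ D1) :
    shadowDeg H (w 0) + shadowDeg H (w t) ≤
      t + 2 * D0.card + 2 * D1.card + 2 * (Fintype.card V - (t + 1)) := by
  classical
  have hne : w 0 ≠ w t := fun e => by
    have := P.winj 0 (by omega) t le_rfl e
    omega
  let N0 := (range t).filter fun s => ∃ g ∈ H, (∀ a < t, h a ≠ g) ∧ w 0 ∈ g ∧ w (s + 1) ∈ g
  let N1 := (range t).filter fun s => ∃ g ∈ H, (∀ a < t, h a ≠ g) ∧ w s ∈ g ∧ w t ∈ g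
  have hdisj : Disjoint N0 N1 := by
    rw [Finset.disjoint_left]
    intro s hs0 hs1
    obtain ⟨hs, g, hg, hgp, g0, g1⟩ := mem_filter.1 hs0
    obtain ⟨-, g', hg', hgp', g0', g1'⟩ := mem_filter.1 hs1
    refine P.cross ht hno s (mem_range.1 hs) g g' ?_ hg hg' hgp hgp' g0 g1 g0' g1'
    rintro rfl
    exact hna ⟨hne, g, hg, g0, g1'⟩
  have hsum : N0.card + N1.card ≤ t := by
    rw [← card_union_of_disjoint hdisj]
    calc _ ≤ (range t).card := card_le_card (union_subset (filter_subset _ _) (filter_subset _ _))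
      _ = t := card_range t
  let W := (range (t + 1)).image w
  have hW : W.card = t + 1 := by
    rw [card_image_of_injOn, card_range]
    intro a ha b hb hab
    simp at ha hb
    exact P.winj a (by omega) b (by omega) hab
  have hWc : (univ \ W).card = Fintype.card V - (t + 1) := by
    rw [card_sdiff_of_subset (subset_univ _), hW, card_univ]
  have key : ∀ (x : V) (N : Finset V) (D : Finset (Finset V)),
      (∀ y ∈ W, y ≠ x → ∀ g ∈ H, x ∈ g → y ∈ g → (∀ a < t, h a ≠ g) → y ∈ N) →
      (∀ a < t, x ∈ h a → h a ∈ D) →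
      shadowDeg H x ≤ N.card + 2 * D.card + (Fintype.card V - (t + 1)) := by
    intro x N D hN hD
    have hsub : {v | HAdj H x v} ⊆
        ((N ∪ (D.filter fun g => g ∈ H ∧ x ∈ g).biUnion (fun g => g.erase x) ∪ (univ \ W) :
          Finset V) : Set V) := by
      rintro y ⟨hxy, g, hg, hx, hy⟩
      by_cases hyW : y ∈ W
      · by_cases hgp : ∀ a < t, h a ≠ g
        · have := hN y hyW (Ne.symm hxy) g hg hx hy hgp
          simp [this]
        · push Not at hgp
          obtain ⟨a, ha, rfl⟩ := hgp
          have := hD a ha hx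
          simp only [coe_union, Set.mem_union, mem_coe, mem_biUnion]
          left; right
          exact ⟨h a, by simp [this, hg, hx], by simp [hy, Ne.symm hxy]⟩
      · simp [hyW]
    unfold shadowDeg
    refine (Set.ncard_le_ncard hsub (Finset.finite_toSet _)).trans ?_
    rw [Set.ncard_coe_finset]
    refine (card_union_le _ _).trans ?_
    rw [hWc]
    refine Nat.add_le_add_right ((card_union_le _ _).trans (Nat.add_le_add_left ?_ _)) _
    refine (card_biUnion_le_card_mul _ _ 2 ?_).trans ?_
    · intro g hg
      simp only [mem_filter] at hg
      rw [card_erase_of_mem hg.2.2]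
      rcases h3 g hg.2.1 with e | e <;> omega
    · rw [mul_comm]
      exact Nat.mul_le_mul_left _ (card_le_card (filter_subset _ _))
  have k0 := key (w 0) (N0.image fun s => w (s + 1)) D0 (by
    intro y hy hyx g hg hx hyg hgp
    obtain ⟨r, hr, rfl⟩ := mem_image.1 hy
    have hr0 : r ≠ 0 := by rintro rfl; exact hyx rfl
    have hr' := mem_range.1 hr
    obtain ⟨s, rfl⟩ := Nat.exists_eq_succ_of_ne_zero hr0
    exact mem_image.2 ⟨s, mem_filter.2 ⟨mem_range.2 (by omega), g, hg, hgp, hx, hyg⟩, rfl⟩) hD0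
  have k1 := key (w t) (N1.image w) D1 (by
    intro y hy hyx g hg hx hyg hgp
    obtain ⟨r, hr, rfl⟩ := mem_image.1 hy
    have hr0 : r ≠ t := by rintro rfl; exact hyx rfl
    have hr' := mem_range.1 hr
    exact mem_image.2 ⟨r, mem_filter.2 ⟨mem_range.2 (by omega), g, hg, hgp, hyg, hx⟩, rfl⟩) hD1
  have c0 : (N0.image fun s => w (s + 1)).card ≤ N0.card := card_image_le
  have c1 : (N1.image w).card ≤ N1.card := card_image_le
  omega

lemma pathOfPair {V : Type*} {H : Finset (Finset V)} {t : ℕ} (C : BergeCycle H t) (ht : 3 ≤ t)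
    (u : V) (hu : u ∉ Set.range C.vtx) (p q : ZMod t) (hpq : p ≠ q) (fp fq : Finset V)
    (hfpH : fp ∈ H) (hfqH : fq ∈ H) (hne : fp ≠ fq) (up : u ∈ fp) (uq : u ∈ fq)
    (vp : C.vtx p ∈ fp) (vq : C.vtx q ∈ fq)
    (hfp : ∀ k, k ≠ p → C.edge k ≠ fp) (hfq : ∀ k, k ≠ q → C.edge k ≠ fq) :
    ∃ (w : ℕ → V) (h : ℕ → Finset V), BPath H t w h ∧ w 0 = C.vtx (p + 1) ∧
      w t = C.vtx (q + 1) ∧ ∀ a < t, h a = fp ∨ h a = fq ∨ ∃ k, h a = C.edge k := by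
  have : NeZero t := ⟨by omega⟩
  obtain ⟨L, hL, hq⟩ : ∃ L : ℕ, L < t ∧ q = p + 1 + (L : ZMod t) :=
    ⟨(q - (p + 1)).val, ZMod.val_lt _, by rw [ZMod.natCast_zmod_val]; ring⟩
  have hp : p = p + 1 + ((t - 1 : ℕ) : ZMod t) := by
    rw [Nat.cast_sub (by omega)]; simp
  have castinj : ∀ a < t, ∀ b < t, p + 1 + (a : ZMod t) = p + 1 + (b : ZMod t) → a = b := by
    intro a ha b hb hab
    have := add_left_cancel hab
    rw [ZMod.natCast_eq_natCast_iff'] at this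
    rwa [Nat.mod_eq_of_lt ha, Nat.mod_eq_of_lt hb] at this
  have hL2 : L ≠ t - 1 := by
    intro e
    apply hpq
    rw [e] at hq
    exact hp.trans hq.symm
  obtain ⟨X, hX⟩ : ∃ X : ℕ → V, ∀ a, X a = C.vtx (p + 1 + (a : ZMod t)) := ⟨_, fun _ => rfl⟩
  obtain ⟨E, hE⟩ : ∃ E : ℕ → Finset V, ∀ a, E a = C.edge (p + 1 + (a : ZMod t)) :=
    ⟨_, fun _ => rfl⟩
  have Xinj : ∀ a < t, ∀ b < t, X a = X b → a = b := by
    intro a ha b hb hab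
    rw [hX, hX] at hab
    exact castinj a ha b hb (C.vtx_inj hab)
  have Einj : ∀ a < t, ∀ b < t, E a = E b → a = b := by
    intro a ha b hb hab
    rw [hE, hE] at hab
    exact castinj a ha b hb (C.edge_inj hab)
  have Xu : ∀ a, X a ≠ u := fun a e => hu ⟨_, (hX a).symm.trans e⟩
  have EH : ∀ a, E a ∈ H := fun a => by rw [hE]; exact C.edge_mem _
  have E1 : ∀ a, X a ∈ E a := fun a => by rw [hE, hX]; exact C.mem_fst _
  have E2 : ∀ a, X (a + 1) ∈ E a := fun a => by
    rw [hE, hX]; push_cast; rw [← add_assoc]; exact C.mem_snd _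
  have Xp : X (t - 1) ∈ fp := by rw [hX, ← hp]; exact vp
  have Xq : X L ∈ fq := by rw [hX, ← hq]; exact vq
  have Ep : ∀ a < t - 1, E a ≠ fp := by
    intro a ha
    rw [hE]
    apply hfp
    intro e
    rw [hp] at e
    have := castinj a (by omega) (t - 1) (by omega) (by rw [← hp] at e; rw [e]; exact hp)
    omega
  have Eq : ∀ a < t, a ≠ L → E a ≠ fq := by
    intro a ha haL
    rw [hE]
    apply hfq
    intro e
    exact haL (castinj a ha L hL (e.trans hq))
  refine ⟨fun r => if r ≤ L then X r else if r = L + 1 then u else X (t + L + 1 - r),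
    fun r => if r < L then E r else if r = L then fq else if r = L + 1 then fp
      else E (t + L - r), ⟨?_, ?_, ?_, ?_, ?_⟩, ?_, ?_, ?_⟩
  · intro a ha b hb hab
    split_ifs at hab
    all_goals first
      | omega
      | exact absurd hab (Xu _)
      | exact absurd hab.symm (Xu _)
      | (have := Xinj _ (by omega) _ (by omega) hab
         omega)
  · intro a ha b hb hab
    split_ifs at hab
    all_goals first
      | omega
      | exact absurd hab hne
      | exact absurd hab.symm hne
      | exact absurd hab (Ep _ (by omega))
      | exact absurd hab.symm (Ep _ (by omega))
      | exact absurd hab (Eq _ (by omega) (by omega))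
      | exact absurd hab.symm (Eq _ (by omega) (by omega))
      | (have := Einj _ (by omega) _ (by omega) hab
         omega)
  · intro a ha
    split_ifs
    all_goals first
      | assumption
      | exact EH _
  · intro a ha
    split_ifs with i1 i2 i3 i4 i5
    all_goals first
      | omega
      | assumption
      | exact E1 _
      | (have e : a = L := by omega
         rw [e]; exact Xq)
      | (convert E2 (t + L - a) using 2; omega)
  · intro a ha
    split_ifs with i1 i2 i3 i4 i5
    all_goals first
      | omega
      | assumption
      | exact E2 _
      | (convert Xp using 2; omega)
      | (convert E1 (t + L - a) using 2; omega)
  · simp [hX]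
  · have a1 : ¬ t ≤ L := by omega
    have a2 : ¬ t = L + 1 := by omega
    simp only [a1, a2, if_false]
    have : t + L + 1 - t = L + 1 := by omega
    rw [this, hX, hq]
    push_cast
    congr 1
    ring
  · intro a ha
    dsimp only
    split_ifs
    · exact Or.inr (Or.inr ⟨_, hE a⟩)
    · simp
    · simp
    · exact Or.inr (Or.inr ⟨_, hE _⟩)

lemma three_false {V : Type*} {H : Finset (Finset V)} (h3 : IsThreeGraph H) (g : Finset V)
    (hg : g ∈ H) (a b c d : V) (ha : a ∈ g) (hb : b ∈ g) (hc : c ∈ g) (hd : d ∈ g)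
    (hab : a ≠ b) (hac : a ≠ c) (had : a ≠ d) (hbc : b ≠ c) (hbd : b ≠ d) (hcd : c ≠ d) :
    False := by
  classical
  have hs : ({a, b, c, d} : Finset V) ⊆ g := by
    intro x hx
    simp at hx
    rcases hx with rfl | rfl | rfl | rfl <;> assumption
  have h4 : ({a, b, c, d} : Finset V).card = 4 := by
    rw [card_insert_of_notMem (by simp [*]), card_insert_of_notMem (by simp [*]),
      card_pair hcd]
  have := card_le_card hs
  rcases h3 g hg with e | e <;> omega

lemma exists_good {V : Type*} {H : Finset (Finset V)} (h3 : IsThreeGraph H)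
    {t : ℕ} (C : BergeCycle H t) (ht : 3 ≤ t)
    (u : V) (hu : u ∉ Set.range C.vtx) :
    ∃ (P : Finset (ZMod t)) (f : ZMod t → Finset V), C.dC u ≤ 2 * P.card ∧
      (∀ p ∈ P, f p ∈ H ∧ u ∈ f p ∧ C.vtx p ∈ f p ∧ ∀ k, k ≠ p → C.edge k ≠ f p) ∧
      (∀ p ∈ P, ∀ q ∈ P, f p = f q → p = q) := by
  classical
  have : NeZero t := ⟨by omega⟩
  have : Fact (1 < t) := ⟨by omega⟩
  have huv : ∀ k, u ≠ C.vtx k := fun k e => hu ⟨k, e.symm⟩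
  let A : Finset (ZMod t) := univ.filter fun p => HAdj H u (C.vtx p)
  have hA : C.dC u = A.card := by
    unfold BergeCycle.dC
    rw [← Set.ncard_coe_finset, ← Set.ncard_image_of_injective _ C.vtx_inj]
    congr 1
    ext y
    simp only [Set.mem_ofPred_eq, Set.mem_range, Set.mem_image, mem_coe, A, mem_filter, mem_univ,
      true_and]
    constructor
    · rintro ⟨⟨k, rfl⟩, hk⟩
      exact ⟨k, hk, rfl⟩
    · rintro ⟨k, hk, rfl⟩
      exact ⟨⟨k, rfl⟩, hk⟩
  have hex : ∀ p, ∃ g, p ∈ A → g ∈ H ∧ u ∈ g ∧ C.vtx p ∈ g := by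
    intro p
    by_cases hp : p ∈ A
    · obtain ⟨-, g, hg⟩ := (mem_filter.1 hp).2
      exact ⟨g, fun _ => hg⟩
    · exact ⟨∅, fun h => absurd h hp⟩
  choose γ hγ using hex
  obtain ⟨φ, hφ⟩ : ∃ φ : ZMod t → Finset V, ∀ p, φ p = if u ∈ C.edge p then C.edge p else
    if u ∈ C.edge (p - 1) then C.edge (p - 1) else γ p := ⟨_, fun _ => rfl⟩
  have hsnd : ∀ p, C.vtx p ∈ C.edge (p - 1) := fun p => by
    have := C.mem_snd (p - 1)
    rwa [sub_add_cancel] at this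
  have hφ1 : ∀ p ∈ A, φ p ∈ H ∧ u ∈ φ p ∧ C.vtx p ∈ φ p := by
    intro p hp
    rw [hφ]
    split_ifs with h1 h2
    · exact ⟨C.edge_mem _, h1, C.mem_fst _⟩
    · exact ⟨C.edge_mem _, h2, hsnd p⟩
    · exact hγ p hp
  have claim : ∀ g ∈ A.image φ, ∃ p, p ∈ A ∧ φ p = g ∧ ∀ k, k ≠ p → C.edge k ≠ g := by
    intro g hg
    obtain ⟨p, hp, rfl⟩ := mem_image.1 hg
    by_cases h1 : u ∈ C.edge p
    · refine ⟨p, hp, rfl, ?_⟩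
      intro k hk e
      rw [hφ, if_pos h1] at e
      exact hk (C.edge_inj e)
    by_cases h2 : u ∈ C.edge (p - 1)
    · refine ⟨p - 1, ?_, ?_, ?_⟩
      · exact mem_filter.2 ⟨mem_univ _, huv _, _, C.edge_mem _, h2, C.mem_fst _⟩
      · rw [hφ, hφ, if_pos h2, if_neg h1, if_pos h2]
      · intro k hk e
        rw [hφ, if_neg h1, if_pos h2] at e
        exact hk (C.edge_inj e)
    · refine ⟨p, hp, rfl, ?_⟩
      intro k hk e
      obtain ⟨a1, a2, a3⟩ := hφ1 p hp
      rw [← e] at a1 a2 a3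
      have hk1 : k + 1 ≠ p := by
        rintro rfl
        rw [add_sub_cancel_right] at h2
        exact h2 a2
      refine three_false h3 _ a1 u (C.vtx p) (C.vtx k) (C.vtx (k + 1)) a2 a3 (C.mem_fst _)
        (C.mem_snd _) (huv _) (huv _) (huv _) ?_ ?_ ?_
      · exact fun e => hk (C.vtx_inj e).symm
      · exact fun e => hk1 (C.vtx_inj e).symm
      · intro e
        have := C.vtx_inj e
        simp at this
  have hcard : A.card ≤ 2 * (A.image φ).card := by
    apply card_le_mul_card_image
    intro g hg
    obtain ⟨p, hp, rfl⟩ := mem_image.1 hg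
    obtain ⟨a1, a2, a3⟩ := hφ1 p hp
    have : ((A.filter fun x => φ x = φ p).image C.vtx) ⊆ (φ p).erase u := by
      intro y hy
      obtain ⟨x, hx, rfl⟩ := mem_image.1 hy
      obtain ⟨hx1, hx2⟩ := mem_filter.1 hx
      rw [mem_erase]
      refine ⟨(huv x).symm, ?_⟩
      rw [← hx2]
      exact (hφ1 x hx1).2.2
    have h := card_le_card this
    rw [card_image_of_injective _ C.vtx_inj, card_erase_of_mem a2] at h
    rcases h3 _ a1 with e | e <;> omega
  choose! ψ hψ using claim
  refine ⟨(A.image φ).image ψ, φ, ?_, ?_, ?_⟩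
  · rw [hA, card_image_of_injOn]
    · exact hcard
    · intro a ha b hb hab
      rw [← (hψ a ha).2.1, ← (hψ b hb).2.1, hab]
  · intro p hp
    obtain ⟨g, hg, rfl⟩ := mem_image.1 hp
    obtain ⟨b1, b2, b3⟩ := hψ g hg
    obtain ⟨c1, c2, c3⟩ := hφ1 _ b1
    refine ⟨c1, c2, c3, ?_⟩
    rw [b2]
    exact b3
  · intro p hp q hq e
    obtain ⟨g, hg, rfl⟩ := mem_image.1 hp
    obtain ⟨g', hg', rfl⟩ := mem_image.1 hq
    rw [(hψ g hg).2.1, (hψ g' hg').2.1] at e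
    rw [e]

open Classical in
/-- Indices of cycle edges containing the cycle vertex with index `i`. -/
noncomputable def KC {V : Type*} {H : Finset (Finset V)} {t : ℕ} [NeZero t]
    (C : BergeCycle H t) (i : ZMod t) : Finset (ZMod t) :=
  univ.filter fun k => C.vtx i ∈ C.edge k

open Classical in
/-- Indices of cycle vertices sharing a cycle edge with the vertex with index `i`. -/
noncomputable def XC {V : Type*} {H : Finset (Finset V)} {t : ℕ} [NeZero t]
    (C : BergeCycle H t) (i : ZMod t) : Finset (ZMod t) :=
  univ.filter fun x => ∃ k, C.vtx i ∈ C.edge k ∧ C.vtx x ∈ C.edge k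

lemma card_XC {V : Type*} {H : Finset (Finset V)} (h3 : IsThreeGraph H) {t : ℕ} [NeZero t]
    (C : BergeCycle H t) (i : ZMod t) : (XC C i).card ≤ 2 * (KC C i).card + 1 := by
  classical
  have hsub : (XC C i).image C.vtx ⊆
      insert (C.vtx i) ((KC C i).biUnion fun k => (C.edge k).erase (C.vtx i)) := by
    intro y hy
    obtain ⟨x, hx, rfl⟩ := mem_image.1 hy
    obtain ⟨-, k, hk1, hk2⟩ := mem_filter.1 hx
    rw [mem_insert]
    by_cases e : C.vtx x = C.vtx i
    · exact Or.inl e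
    · right
      exact mem_biUnion.2 ⟨k, mem_filter.2 ⟨mem_univ _, hk1⟩, mem_erase.2 ⟨e, hk2⟩⟩
  have h := card_le_card hsub
  rw [card_image_of_injective _ C.vtx_inj] at h
  have h' := card_insert_le (C.vtx i) ((KC C i).biUnion fun k => (C.edge k).erase (C.vtx i))
  have h'' := card_biUnion_le_card_mul (KC C i) (fun k => (C.edge k).erase (C.vtx i)) 2 (by
    intro k hk
    have hk := (mem_filter.1 hk).2
    rw [card_erase_of_mem hk]
    rcases h3 _ (C.edge_mem k) with e | e <;> omega)
  omega

lemma exists_small_KC {V : Type*} {H : Finset (Finset V)} (h3 : IsThreeGraph H) {t : ℕ} [NeZero t]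
    (ht : 3 ≤ t) (C : BergeCycle H t) (S : Finset (ZMod t)) (hS : t < 8 * S.card) :
    ∃ i ∈ S, (KC C i).card ≤ 9 := by
  classical
  have : Fact (1 < t) := ⟨by omega⟩
  by_contra hcon
  push Not at hcon
  let r : ZMod t → ZMod t → Prop := fun i k => i ≠ k ∧ i ≠ k + 1 ∧ C.vtx i ∈ C.edge k
  have h1 := sum_card_bipartiteAbove_eq_sum_card_bipartiteBelow (s := S) (t := univ) r
  have h2 : ∀ i ∈ S, 8 ≤ (bipartiteAbove r univ i).card := by
    intro i hi
    have hc := hcon i hi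
    have hsub : KC C i ⊆ insert i (insert (i - 1) (bipartiteAbove r univ i)) := by
      intro k hk
      have hk := (mem_filter.1 hk).2
      simp only [mem_insert, bipartiteAbove, mem_filter, mem_univ, true_and]
      by_cases e1 : k = i
      · exact Or.inl e1
      by_cases e2 : k = i - 1
      · exact Or.inr (Or.inl e2)
      · refine Or.inr (Or.inr ⟨fun e => e1 e.symm, fun e => e2 ?_, hk⟩)
        rw [e]; ring
    have := card_le_card hsub
    have := card_insert_le i (insert (i - 1) (bipartiteAbove r univ i))
    have := card_insert_le (i - 1) (bipartiteAbove r univ i)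
    omega
  have h4 : ∀ k ∈ (univ : Finset (ZMod t)), (bipartiteBelow r S k).card ≤ 1 := by
    intro k _
    rw [card_le_one]
    intro a ha b hb
    obtain ⟨-, a1, a2, a3⟩ := mem_filter.1 ha
    obtain ⟨-, b1, b2, b3⟩ := mem_filter.1 hb
    by_contra hab
    have inj : ∀ {a b}, C.vtx a ≠ C.vtx b ↔ a ≠ b := C.vtx_inj.ne_iff
    refine three_false h3 _ (C.edge_mem k) _ _ _ _ a3 b3 (C.mem_fst k) (C.mem_snd k)
      (inj.2 hab) (inj.2 a1) (inj.2 a2) (inj.2 b1) (inj.2 b2) (inj.2 ?_)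
    intro e
    simp at e
  have h5 := card_nsmul_le_sum S _ 8 h2
  have h6 := sum_le_card_nsmul univ _ 1 h4
  rw [card_univ, ZMod.card] at h6
  simp only [smul_eq_mul] at h5 h6
  omega

lemma pairBound {V : Type*} [Fintype V] {H : Finset (Finset V)} (h3 : IsThreeGraph H)
    {t : ℕ} [NeZero t] (C : BergeCycle H t) (ht : 3 ≤ t)
    (hno : IsEmpty (BergeCycle H (t + 1)))
    (u : V) (hu : u ∉ Set.range C.vtx) (p q : ZMod t) (hX : q + 1 ∉ XC C (p + 1))
    (fp fq : Finset V)
    (hfpH : fp ∈ H) (hfqH : fq ∈ H) (hne : fp ≠ fq) (up : u ∈ fp) (uq : u ∈ fq)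
    (vp : C.vtx p ∈ fp) (vq : C.vtx q ∈ fq)
    (hfp : ∀ k, k ≠ p → C.edge k ≠ fp) (hfq : ∀ k, k ≠ q → C.edge k ≠ fq) :
    C.vtx (p + 1) ≠ C.vtx (q + 1) ∧ ¬ HAdj H (C.vtx (p + 1)) (C.vtx (q + 1)) ∧
    shadowDeg H (C.vtx (p + 1)) + shadowDeg H (C.vtx (q + 1)) ≤
      t + 2 * ((KC C (p + 1)).card + 2) + 2 * ((KC C (q + 1)).card + 2) +
        2 * (Fintype.card V - (t + 1)) := by
  classical
  have : Fact (1 < t) := ⟨by omega⟩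
  have huv : ∀ k, u ≠ C.vtx k := fun k e => hu ⟨k, e.symm⟩
  have inj : ∀ {a b}, C.vtx a ≠ C.vtx b ↔ a ≠ b := C.vtx_inj.ne_iff
  have hX' : ∀ k, C.vtx (p + 1) ∈ C.edge k → C.vtx (q + 1) ∈ C.edge k → False :=
    fun k a b => hX (mem_filter.2 ⟨mem_univ _, k, a, b⟩)
  have n1 : p + 1 ≠ q + 1 := by
    intro e
    refine hX' (p + 1) (C.mem_fst _) ?_
    rw [← e]; exact C.mem_fst _
  have n2 : p ≠ q := fun e => n1 (by rw [e])
  have n3 : p ≠ q + 1 := by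
    intro e
    refine hX' p (C.mem_snd _) ?_
    rw [← e]; exact C.mem_fst _
  have n4 : q ≠ p + 1 := by
    intro e
    refine hX' q ?_ (C.mem_snd _)
    rw [← e]; exact C.mem_fst _
  have n5 : p ≠ p + 1 := by simp
  have n6 : q ≠ q + 1 := by simp
  obtain ⟨w, h, P, hw0, hwt, hh⟩ := pathOfPair C ht u hu p q n2 fp fq hfpH hfqH hne up uq vp vq
    hfp hfq
  have hna : ¬ HAdj H (C.vtx (p + 1)) (C.vtx (q + 1)) := by
    rintro ⟨-, g, hg, g1, g2⟩
    by_cases hgp : ∀ a < t, h a ≠ g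
    · exact P.close (by omega) hno g hg hgp (by rw [hw0]; exact g1) (by rw [hwt]; exact g2)
    · push Not at hgp
      obtain ⟨a, ha, rfl⟩ := hgp
      rcases hh a ha with e | e | ⟨k, e⟩
      · rw [e] at g1 g2
        exact three_false h3 _ hfpH _ _ _ _ up vp g1 g2 (huv _) (huv _) (huv _) (inj.2 n5)
          (inj.2 n3) (inj.2 n1)
      · rw [e] at g1 g2
        exact three_false h3 _ hfqH _ _ _ _ uq vq g1 g2 (huv _) (huv _) (huv _) (inj.2 n4)
          (inj.2 n6) (inj.2 n1)
      · rw [e] at g1 g2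
        exact hX' k g1 g2
  refine ⟨inj.2 n1, hna, ?_⟩
  have hD : ∀ i, ∀ a < t, C.vtx i ∈ h a → h a ∈ insert fp (insert fq ((KC C i).image C.edge)) := by
    intro i a ha hi
    rw [mem_insert, mem_insert]
    rcases hh a ha with e | e | ⟨k, e⟩
    · exact Or.inl e
    · exact Or.inr (Or.inl e)
    · rw [e] at hi ⊢
      exact Or.inr (Or.inr (mem_image_of_mem _ (mem_filter.2 ⟨mem_univ _, hi⟩)))
  have hDc : ∀ i, (insert fp (insert fq ((KC C i).image C.edge))).card ≤ (KC C i).card + 2 := by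
    intro i
    have := card_insert_le fp (insert fq ((KC C i).image C.edge))
    have := card_insert_le fq ((KC C i).image C.edge)
    have : ((KC C i).image C.edge).card ≤ _ := card_image_le
    omega
  have := P.ore h3 (by omega) hno (by rwa [hw0, hwt]) _ _
    (by rw [hw0]; exact hD (p + 1)) (by rw [hwt]; exact hD (q + 1))
  rw [hw0, hwt] at this
  have := hDc (p + 1)
  have := hDc (q + 1)
  omega

/-- The degree in the shadow is at most `d_C` plus the number of other vertices off the cycle. -/
lemma shadow_le {V : Type*} [Fintype V] {H : Finset (Finset V)}
    {t : ℕ} [NeZero t] (C : BergeCycle H t) (x y : V) (hy : y ∉ Set.range C.vtx)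
    (hxy : ¬ HAdj H x y) :
    shadowDeg H x ≤ C.dC x + (Fintype.card V - t - 1) := by
  classical
  let W := insert y ((univ : Finset (ZMod t)).image C.vtx)
  have hW : W.card = t + 1 := by
    rw [card_insert_of_notMem, card_image_of_injective _ C.vtx_inj, card_univ, ZMod.card]
    simpa using hy
  have hWc : (univ \ W).card = Fintype.card V - t - 1 := by
    rw [card_sdiff_of_subset (subset_univ _), hW, card_univ]
    omega
  have hsub : {z | HAdj H x z} ⊆
      {z | z ∈ Set.range C.vtx ∧ HAdj H x z} ∪ ((univ \ W : Finset V) : Set V) := by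
    intro z hz
    by_cases hzC : z ∈ Set.range C.vtx
    · exact Or.inl ⟨hzC, hz⟩
    · right
      have : z ≠ y := by rintro rfl; exact hxy hz
      simp only [W, coe_sdiff, coe_univ, Set.mem_sdiff, Set.mem_univ, true_and, mem_coe,
        mem_insert, mem_image, mem_univ, not_or]
      exact ⟨this, fun ⟨k, hk⟩ => hzC ⟨k, hk⟩⟩
  unfold shadowDeg BergeCycle.dC
  refine (Set.ncard_le_ncard hsub (Set.toFinite _)).trans ?_
  refine (Set.ncard_union_le _ _).trans ?_
  rw [Set.ncard_coe_finset, hWc]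

end Helpers

/-- Any vertex `u` off a longest Berge cycle `C` is adjacent to
every other vertex of `S(C) ∪ B₁(C)`, where `S(C) = {v : d_C(v) < (n+65)/2 - 3}`
and `B₁(C) = {v : (n+65)/2 - 3 ≤ d_C(v) < 3n/4 + 13}`. -/
theorem stmt13 {V : Type*} [Fintype V] (n : ℕ) (hn : 69 ≤ n)
    (hcard : Fintype.card V = n) (H : Finset (Finset V)) (h3 : IsThreeGraph H)
    (hOre : ∀ u v : V, u ≠ v → ¬ HAdj H u v →
      n + 65 ≤ shadowDeg H u + shadowDeg H v)
    (hnoham : ¬ HamiltonianBergeCycle H)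
    {t : ℕ} (C : BergeCycle H t)
    (hlong : ∀ (t' : ℕ) (C' : BergeCycle H t'), t' ≤ t)
    (ht : t = n - 1 ∨ t = n - 2)
    (u : V) (hu : u ∉ Set.range C.vtx)
    (v : V) (hv : v ≠ u)
    (hdeg : (C.dC v : ℚ) < (n + 65 : ℚ) / 2 - 3 ∨
      ((n + 65 : ℚ) / 2 - 3 ≤ (C.dC v : ℚ) ∧ (C.dC v : ℚ) < 3 * (n : ℚ) / 4 + 13)) :
    HAdj H u v := by
  classical
  have ht3 : 3 ≤ t := by omega
  have : NeZero t := ⟨by omega⟩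
  have hno : IsEmpty (BergeCycle H (t + 1)) := ⟨fun c => by
    have := hlong _ c
    omega⟩
  by_contra hadj
  have hadj' : ¬ HAdj H v u := fun ⟨h1, e, he, h2, h3⟩ => hadj ⟨h1.symm, e, he, h3, h2⟩
  have huu : ¬ HAdj H u u := fun h => h.1 rfl
  have d1 := hOre u v hv.symm hadj
  have d2 := shadow_le C v u hu hadj'
  have d3 := shadow_le C u u hu huu
  have d4 : 4 * C.dC v < 3 * n + 52 := by
    have hq : (69 : ℚ) ≤ n := by exact_mod_cast hn
    have : (4 * C.dC v : ℚ) < 3 * n + 52 := by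
      rcases hdeg with h | ⟨-, h⟩
      · linarith
      · linarith
    exact_mod_cast this
  rw [hcard] at d2 d3
  obtain ⟨P, f, hPc, hP, hPinj⟩ := exists_good h3 C ht3 u hu
  let I := P.image (fun p => p + 1)
  have hI : I.card = P.card := Finset.card_image_of_injective _ (add_left_injective 1)
  obtain ⟨i, hi, hKi⟩ := exists_small_KC h3 ht3 C I (by omega)
  have hXi := card_XC h3 C i
  have hsd := Finset.le_card_sdiff (XC C i) I
  obtain ⟨j, hj, hKj⟩ := exists_small_KC h3 ht3 C (I \ XC C i) (by omega)
  obtain ⟨hjI, hjX⟩ := Finset.mem_sdiff.1 hj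
  obtain ⟨p, hp, rfl⟩ := Finset.mem_image.1 hi
  obtain ⟨q, hq, rfl⟩ := Finset.mem_image.1 hjI
  obtain ⟨p1, p2, p3, p4⟩ := hP p hp
  obtain ⟨q1, q2, q3, q4⟩ := hP q hq
  have hne : f p ≠ f q := by
    intro e
    have := hPinj p hp q hq e
    subst this
    exact hjX (Finset.mem_filter.2 ⟨Finset.mem_univ _, _, C.mem_fst _, C.mem_fst _⟩)
  obtain ⟨b1, b2, b3⟩ := pairBound h3 C ht3 hno u hu p q hjX (f p) (f q) p1 q1 hne p2 q2 p3 q3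
    p4 q4
  have b4 := hOre _ _ b1 b2
  rw [hcard] at b3
  omega
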